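/- Let a > 0, let n be an even positive integer, and let k, λ be real with λ ≠ 0. Then (1/(2π))·|∫_{-a/2}^{a/2} √(2/a)·sin(nπx/a)·exp(-i·(k - iλ)·x) dx|² = 4π n²·(sin²(ka/2)·cosh²(λa/2) + cos²(ka/2)·sinh²(λa/2)) / (a³·((k² − λ² − π²n²/a²)² + 4λ²k²)). -/

import Mathlib

open Real Complex

theorem aux_integral (b c : ℂ) (h : c ^ 2 + b ^ 2 ≠ 0) (r : ℝ) :
    ∫ x in (-r)..r, Complex.sin (b * (x : ℂ)) * Complex.exp (c * (x : ℂ)) =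
      (Complex.exp (c * r) * (c * Complex.sin (b * r) - b * Complex.cos (b * r))) / (c ^ 2 + b ^ 2)
      - (Complex.exp (c * (-r : ℝ)) *
        (c * Complex.sin (b * (-r : ℝ)) - b * Complex.cos (b * (-r : ℝ)))) / (c ^ 2 + b ^ 2) := by
  refine intervalIntegral.integral_eq_sub_of_hasDerivAt
    (f := fun x : ℝ => (Complex.exp (c * x) *
      (c * Complex.sin (b * x) - b * Complex.cos (b * x))) / (c ^ 2 + b ^ 2)) ?_ ?_
  · intro x _
    have h0 : ∀ d : ℂ, HasDerivAt (fun z : ℂ => d * z) d (x : ℂ) := fun d => by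
      simpa using (hasDerivAt_id (x : ℂ)).const_mul d
    have h1 := (((h0 c).cexp).mul
      ((((h0 b).csin).const_mul c).sub (((h0 b).ccos).const_mul b))).div_const (c ^ 2 + b ^ 2)
    have h2 := h1.comp_ofReal
    refine h2.congr_deriv ?_
    simp only [Pi.sub_apply]
    rw [div_eq_iff h]
    ring
  · apply Continuous.intervalIntegrable
    fun_prop

theorem stmt_14 (a : ℝ) (ha : 0 < a) (n : ℕ) (hn : 0 < n) (heven : Even n)
    (k lam : ℝ) (hlam : lam ≠ 0) :
    1 / (2 * π) *
      norm (∫ x in (-(a / 2))..(a / 2),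
        ((Real.sqrt (2 / a) * Real.sin (n * π * x / a) : ℝ) : ℂ) *
          Complex.exp (-Complex.I * ((k : ℂ) - Complex.I * lam) * x)) ^ 2 =
    4 * π * n ^ 2 *
        (Real.sin (k * a / 2) ^ 2 * Real.cosh (lam * a / 2) ^ 2 +
          Real.cos (k * a / 2) ^ 2 * Real.sinh (lam * a / 2) ^ 2) /
      (a ^ 3 * ((k ^ 2 - lam ^ 2 - π ^ 2 * n ^ 2 / a ^ 2) ^ 2 + 4 * lam ^ 2 * k ^ 2)) := by
  obtain ⟨m, rfl⟩ := heven
  set b : ℝ := ((m + m : ℕ) : ℝ) * π / a with hb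
  have hbpos : 0 < b := by
    have : (0 : ℝ) < ((m + m : ℕ) : ℝ) := by exact_mod_cast hn
    positivity
  set c : ℂ := -Complex.I * ((k : ℂ) - Complex.I * lam) with hc
  have hD : c ^ 2 + (b : ℂ) ^ 2 =
      ((lam ^ 2 - k ^ 2 + b ^ 2 : ℝ) : ℂ) + ((2 * lam * k : ℝ) : ℂ) * Complex.I := by
    rw [hc]; push_cast; ring_nf; simp only [Complex.I_sq, Complex.I_pow_three, Complex.I_pow_four]; ring
  have hDn : Complex.normSq (c ^ 2 + (b : ℂ) ^ 2) =
      (k ^ 2 - lam ^ 2 - b ^ 2) ^ 2 + 4 * lam ^ 2 * k ^ 2 := by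
    rw [hD, Complex.normSq_add_mul_I]; ring
  have hpos : 0 < (k ^ 2 - lam ^ 2 - b ^ 2) ^ 2 + 4 * lam ^ 2 * k ^ 2 := by
    by_cases hk : k = 0
    · subst hk
      have : 0 < lam ^ 2 + b ^ 2 := by positivity
      have := pow_pos this 2
      nlinarith
    · positivity
  have hne : c ^ 2 + (b : ℂ) ^ 2 ≠ 0 := by
    intro h0
    rw [h0, map_zero] at hDn
    linarith
  have hint : (∫ x in (-(a / 2))..(a / 2),
        ((Real.sqrt (2 / a) * Real.sin (((m + m : ℕ) : ℝ) * π * x / a) : ℝ) : ℂ) *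
          Complex.exp (c * x)) = (Real.sqrt (2 / a) : ℂ) *
      ∫ x in (-(a / 2))..(a / 2), Complex.sin (b * (x : ℂ)) * Complex.exp (c * (x : ℂ)) := by
    rw [← intervalIntegral.integral_const_mul]
    congr 1
    ext x
    have : ((m + m : ℕ) : ℝ) * π * x / a = b * x := by rw [hb]; ring
    rw [this]; push_cast; ring
  have hba : (b : ℂ) * ((a / 2 : ℝ) : ℂ) = ((m * π : ℝ) : ℂ) := by
    rw [← Complex.ofReal_mul]; congr 1; rw [hb]; push_cast; field_simp; ring
  have hs : Complex.sin (b * ((a / 2 : ℝ) : ℂ)) = 0 := by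
    rw [hba, ← Complex.ofReal_sin, Real.sin_nat_mul_pi]; simp
  have hco : Complex.cos (b * ((a / 2 : ℝ) : ℂ)) = (-1) ^ m := by
    rw [hba, ← Complex.ofReal_cos, Real.cos_nat_mul_pi]; simp
  have hS : Complex.sinh (c * ((a / 2 : ℝ) : ℂ)) =
      -(((Real.sinh (lam * a / 2) * Real.cos (k * a / 2) : ℝ) : ℂ) +
        ((Real.cosh (lam * a / 2) * Real.sin (k * a / 2) : ℝ) : ℂ) * Complex.I) := by
    have : c * ((a / 2 : ℝ) : ℂ) =
        -(((lam * a / 2 : ℝ) : ℂ) + ((k * a / 2 : ℝ) : ℂ) * Complex.I) := by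
      rw [hc]; push_cast; ring_nf; simp only [Complex.I_sq]; ring
    rw [this, Complex.sinh_neg, Complex.sinh_add, Complex.sinh_mul_I, Complex.cosh_mul_I]
    push_cast; ring
  have hval : (∫ x in (-(a / 2))..(a / 2), Complex.sin (b * (x : ℂ)) * Complex.exp (c * (x : ℂ)))
      = -(2 * (b : ℂ) * (-1) ^ m * Complex.sinh (c * ((a / 2 : ℝ) : ℂ)) / (c ^ 2 + (b : ℂ) ^ 2)) := by
    rw [aux_integral _ _ hne]
    rw [Complex.ofReal_neg, mul_neg, mul_neg, Complex.sin_neg, Complex.cos_neg, hs, hco,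
      Complex.sinh]
    ring
  rw [hint, hval, hS, ← Complex.normSq_eq_norm_sq]
  simp only [map_mul, map_div₀, Complex.normSq_neg, Complex.normSq_add_mul_I, hDn, map_pow,
    Complex.normSq_ofReal, map_one, one_pow]
  rw [Real.mul_self_sqrt (by positivity)]
  have hb2 : π ^ 2 * ((m + m : ℕ) : ℝ) ^ 2 / a ^ 2 = b ^ 2 := by rw [hb]; ring
  have hn2 : ((m + m : ℕ) : ℝ) = b * a / π := by rw [hb]; field_simp
  rw [hb2]
  have h2 : Complex.normSq 2 = 4 := by
    rw [Complex.normSq_ofNat]; norm_num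
  rw [h2, hn2]
  clear_value b
  have := hpos.ne'
  have := Real.pi_pos
  field_simp
  ring
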